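/- Elliptic H² estimate for the Q-tensor equation with small L^∞ norm: let ζ > 0, L₄ ≠ 0, a ∈ ℝ, c > 0, and 0 < η < (1/121)(ζ/L₄)². Suppose Q ∈ H²(𝕋², 𝒮₀^{(2)}) with ‖Q‖_{L^∞(𝕋²)} ≤ √η satisfies ζΔQ_{ij} + 2L₄ ∂_k(∂_lQ_{ij} Q_{lk}) − L₄ ∂_iQ_{kl}∂_jQ_{kl} + (L₄/2)|∇Q|² δ_{ij} − aQ_{ij} − c tr(Q²) Q_{ij} = g_{ij} on 𝕋² for some g ∈ L²(𝕋²). Then ‖Q‖_{H²(𝕋²)} ≤ C(‖g‖_{L²} + 1) where C depends only on a, c, L₄, ζ, η and 𝕋². -/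

import Mathlib

open MeasureTheory

/-- Partial derivative in direction `i` of a function on `ℝ²`. -/
noncomputable def pd (i : Fin 2) (f : (Fin 2 → ℝ) → ℝ) : (Fin 2 → ℝ) → ℝ :=
  fun x => fderiv ℝ f x (Pi.single i 1)

/-- The fundamental cell `[0,1]²` of the torus `𝕋²`. -/
def T2 : Set (Fin 2 → ℝ) := Set.univ.pi fun _ => Set.Icc (0:ℝ) 1

/-- `f` is `1`-periodic in each coordinate direction (i.e. lives on the torus `𝕋²`). -/
def Per (f : (Fin 2 → ℝ) → ℝ) : Prop :=
  ∀ (x : Fin 2 → ℝ) (i : Fin 2), f (x + Pi.single i 1) = f x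

section Calculus

variable {f g : (Fin 2 → ℝ) → ℝ}

lemma ContDiff.pd_two (hf : ContDiff ℝ 2 f) (i : Fin 2) : ContDiff ℝ 1 (pd i f) :=
  (hf.fderiv_right (m := 1) (by norm_num)).clm_apply contDiff_const

lemma ContDiff.continuous_pd (hf : ContDiff ℝ 1 f) (i : Fin 2) : Continuous (pd i f) :=
  (hf.continuous_fderiv (by norm_num)).clm_apply continuous_const

lemma pd_add (hf : ContDiff ℝ 1 f) (hg : ContDiff ℝ 1 g) (i : Fin 2) (x : Fin 2 → ℝ) :
    pd i (fun y => f y + g y) x = pd i f x + pd i g x := by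
  have hf' := hf.differentiable (by norm_num) x
  have hg' := hg.differentiable (by norm_num) x
  simp only [pd]
  rw [fderiv_fun_add hf' hg']
  rfl

lemma pd_mul (hf : ContDiff ℝ 1 f) (hg : ContDiff ℝ 1 g) (i : Fin 2) (x : Fin 2 → ℝ) :
    pd i (fun y => f y * g y) x = f x * pd i g x + pd i f x * g x := by
  have hf' := hf.differentiable (by norm_num) x
  have hg' := hg.differentiable (by norm_num) x
  simp only [pd]
  rw [fderiv_fun_mul hf' hg']
  simp [mul_comm]

lemma pd_neg (i : Fin 2) : pd i (fun y => -f y) = fun y => -pd i f y := by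
  funext x
  simp only [pd]
  rw [fderiv_fun_neg]
  rfl

lemma pd_comm (hf : ContDiff ℝ 2 f) (i j : Fin 2) : pd i (pd j f) = pd j (pd i f) := by
  funext x
  have hd : DifferentiableAt ℝ (fderiv ℝ f) x :=
    (hf.fderiv_right (m := 1) (by norm_num)).differentiable (by norm_num) x
  have key (k l : Fin 2) :
      pd k (pd l f) x = fderiv ℝ (fderiv ℝ f) x (Pi.single k 1) (Pi.single l 1) := by
    change fderiv ℝ (fun y => fderiv ℝ f y (Pi.single l 1)) x (Pi.single k 1) = _
    rw [fderiv_clm_apply hd (differentiableAt_const _)]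
    simp
  rw [key, key]
  exact (hf.contDiffAt.isSymmSndFDerivAt (by simp)).eq _ _

lemma pd_comp_add (i : Fin 2) (v : Fin 2 → ℝ) :
    pd i (fun x => f (x + v)) = fun x => pd i f (x + v) := by
  funext x
  simp only [pd, fderiv_comp_add_right]

lemma Per.pd (hf : Per f) (i : Fin 2) : Per (pd i f) := by
  intro x j
  have h : (fun y => f (y + Pi.single j 1)) = f := funext fun y => hf y j
  rw [← congrFun (pd_comp_add i _) x, h]

lemma isCompact_T2 : IsCompact T2 := isCompact_univ_pi fun _ => isCompact_Icc

lemma integrableOn_T2 (hf : Continuous f) : IntegrableOn f T2 :=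
  hf.continuousOn.integrableOn_compact isCompact_T2

lemma volume_real_T2 : volume.real T2 = 1 := by
  rw [T2, Measure.real, volume_pi_pi]
  simp

lemma setIntegral_T2_mono (hf : Continuous f) (hg : Continuous g) (h : ∀ x, f x ≤ g x) :
    ∫ x in T2, f x ≤ ∫ x in T2, g x :=
  setIntegral_mono (integrableOn_T2 hf) (integrableOn_T2 hg) h

lemma setIntegral_T2_eq (hf : Continuous f) :
    ∫ x in T2, f x = ∫ s in (0:ℝ)..1, ∫ t in (0:ℝ)..1, f ![s, t] := by
  have hT : (MeasurableEquiv.finTwoArrow (α := ℝ)).symm ⁻¹' T2 =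
      Set.Icc (0:ℝ) 1 ×ˢ Set.Icc (0:ℝ) 1 := by
    ext ⟨s, t⟩
    simp [T2, -Set.pi_univ_Icc, MeasurableEquiv.finTwoArrow, Set.mem_pi]
    tauto
  have hc : Continuous fun z : ℝ × ℝ => f ![z.1, z.2] := by fun_prop
  rw [← ((volume_preserving_finTwoArrow ℝ).symm _).setIntegral_preimage_emb
    (MeasurableEquiv.measurableEmbedding _), hT]
  change ∫ z : ℝ × ℝ in _, f ![z.1, z.2] = _
  rw [Measure.volume_eq_prod, setIntegral_prod]
  · simp_rw [intervalIntegral.integral_of_le zero_le_one, integral_Icc_eq_integral_Ioc]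
  · exact hc.continuousOn.integrableOn_compact (isCompact_Icc.prod isCompact_Icc)

lemma setIntegral_T2_shift (hf : Continuous f) (hp : Per f) (i : Fin 2) (r : ℝ) :
    ∫ x in T2, f (x + Pi.single i r) = ∫ x in T2, f x := by
  have shift {h : ℝ → ℝ} (hh : Function.Periodic h 1) :
      ∫ s in (0:ℝ)..1, h (s + r) = ∫ s in (0:ℝ)..1, h s := by
    rw [intervalIntegral.integral_comp_add_right, zero_add, add_comm 1 r,
      hh.intervalIntegral_add_eq r 0, zero_add]
  rw [setIntegral_T2_eq (by fun_prop), setIntegral_T2_eq hf]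
  fin_cases i
  · have e (s t : ℝ) : ![s, t] + Pi.single (0 : Fin 2) r = ![s + r, t] := by
      ext k; fin_cases k <;> simp
    simp only [Fin.zero_eta, e]
    refine shift (h := fun s => ∫ t in (0:ℝ)..1, f ![s, t]) fun s => ?_
    refine intervalIntegral.integral_congr fun t _ => ?_
    rw [← hp ![s, t] 0]
    congr 1
    ext k; fin_cases k <;> simp
  · have e (s t : ℝ) : ![s, t] + Pi.single (1 : Fin 2) r = ![s, t + r] := by
      ext k; fin_cases k <;> simp
    simp only [Fin.mk_one, e]
    refine intervalIntegral.integral_congr fun s _ => ?_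
    refine shift (h := fun t => f ![s, t]) fun t => ?_
    change f ![s, t + 1] = f ![s, t]
    rw [← hp ![s, t] 1]
    congr 1
    ext k; fin_cases k <;> simp

lemma hasDerivAt_setIntegral_T2_mul_shift (hf : Continuous f) (hg : ContDiff ℝ 1 g) (i : Fin 2) :
    HasDerivAt (fun r : ℝ => ∫ x in T2, f x * g (x + Pi.single i r))
      (∫ x in T2, f x * pd i g x) 0 := by
  have hgc : Continuous g := hg.continuous
  have hsc : Continuous fun r : ℝ => (Pi.single i r : Fin 2 → ℝ) :=
    continuous_single (A := fun _ => ℝ) i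
  have hgi := hg.continuous_pd i
  obtain ⟨M, hM⟩ :=
    ((isCompact_Icc (a := (-1:ℝ)) (b := 1)).prod isCompact_T2).exists_bound_of_continuousOn
    (f := fun z : ℝ × (Fin 2 → ℝ) => f z.2 * pd i g (z.2 + Pi.single i z.1)) (by fun_prop)
  have main := hasDerivAt_integral_of_dominated_loc_of_deriv_le
    (μ := volume.restrict T2) (F := fun (r : ℝ) x => f x * g (x + Pi.single i r))
    (F' := fun (r : ℝ) x => f x * pd i g (x + Pi.single i r)) (x₀ := 0)
    (s := Set.Icc (-1) 1) (bound := fun _ => M) (Icc_mem_nhds (by norm_num) (by norm_num))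
    (.of_forall fun r => (integrableOn_T2 (by fun_prop)).aestronglyMeasurable)
    (integrableOn_T2 (by fun_prop)) (integrableOn_T2 (by fun_prop)).aestronglyMeasurable
    ?_ (integrableOn_T2 continuous_const) ?_
  · simpa using main.2
  · filter_upwards [ae_restrict_mem isCompact_T2.measurableSet] with x hx r hr
    exact hM (r, x) ⟨hr, hx⟩
  · refine .of_forall fun x r _ => HasDerivAt.const_mul _ ?_
    have h1 : HasDerivAt (fun r : ℝ => x + (Pi.single i r : Fin 2 → ℝ)) (Pi.single i 1) r :=
      (hasDerivAt_single i r).const_add x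
    exact (hg.differentiable (by norm_num) _).hasFDerivAt.comp_hasDerivAt r h1

lemma setIntegral_T2_pd (hf : ContDiff ℝ 1 f) (hp : Per f) (i : Fin 2) :
    ∫ x in T2, pd i f x = 0 := by
  have h := hasDerivAt_setIntegral_T2_mul_shift (f := fun _ => 1) continuous_const hf i
  simp only [one_mul, setIntegral_T2_shift hf.continuous hp] at h
  exact h.unique (hasDerivAt_const _ _)

lemma setIntegral_T2_mul_pd (hf : ContDiff ℝ 1 f) (hg : ContDiff ℝ 1 g) (hfp : Per f)
    (hgp : Per g) (i : Fin 2) :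
    ∫ x in T2, pd i f x * g x = -∫ x in T2, f x * pd i g x := by
  have h := setIntegral_T2_pd (hf.mul hg) (fun x j => by simp only [hfp x j, hgp x j]) i
  simp only [pd_mul hf hg] at h
  have h1 := hf.continuous
  have h2 := hg.continuous
  have h3 := hf.continuous_pd i
  have h4 := hg.continuous_pd i
  rw [integral_add (integrableOn_T2 (by fun_prop)) (integrableOn_T2 (by fun_prop))] at h
  linarith

lemma setIntegral_T2_hessian (hf : ContDiff ℝ 2 f) (hp : Per f) (i j : Fin 2) :
    ∫ x in T2, pd i (pd i f) x * pd j (pd j f) x = ∫ x in T2, pd i (pd j f) x ^ 2 := by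
  have hi := hf.pd_two i
  have hj := hf.pd_two j
  have hii := hi.continuous_pd i
  have hij := hj.continuous_pd i
  have hd := hasDerivAt_setIntegral_T2_mul_shift hii hj j
  have hd' := hasDerivAt_setIntegral_T2_mul_shift hij hi j
  have hneg : HasDerivAt (fun r : ℝ => -r) (-1) 0 := hasDerivAt_neg 0
  have hd'' := (HasDerivAt.comp (0:ℝ) (by simpa using hd') hneg).neg
  have e (r : ℝ) : ∫ x in T2, pd i (pd i f) x * pd j f (x + Pi.single j r) =
      -∫ x in T2, pd i (pd j f) x * pd i f (x + Pi.single j (-r)) := by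
    have hs : ContDiff ℝ 1 fun x => pd j f (x + (Pi.single j r : Fin 2 → ℝ)) := by fun_prop
    have hsp : Per fun x => pd j f (x + (Pi.single j r : Fin 2 → ℝ)) := fun x k => by
      simp only [add_right_comm x, hp.pd j _ k]
    rw [setIntegral_T2_mul_pd hi hs (hp.pd i) hsp]
    have e1 : pd i (fun x => pd j f (x + (Pi.single j r : Fin 2 → ℝ))) =
        fun x => pd i (pd j f) (x + Pi.single j r) := pd_comp_add i _
    have hic := hi.continuous
    rw [e1, ← setIntegral_T2_shift
      (f := fun x => pd i (pd j f) x * pd i f (x + (Pi.single j (-r) : Fin 2 → ℝ)))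
      (by fun_prop) (fun x k => by
        simp only [add_right_comm x, hp.pd i _ k, (hp.pd j).pd i _ k]) j r]
    congr 2
    funext x
    rw [add_assoc, ← Pi.single_add]
    simp [mul_comm]
  simp only [e] at hd
  have := hd.unique hd''
  rw [this, pd_comm hf j i]
  simp [sq]

lemma setIntegral_T2_laplacian_sq (hf : ContDiff ℝ 2 f) (hp : Per f) :
    ∫ x in T2, (pd 0 (pd 0 f) x + pd 1 (pd 1 f) x) ^ 2 =
      ∫ x in T2, (pd 0 (pd 0 f) x ^ 2 + 2 * pd 0 (pd 1 f) x ^ 2 + pd 1 (pd 1 f) x ^ 2) := by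
  have h := setIntegral_T2_hessian hf hp 0 1
  have h0 := (hf.pd_two 0).continuous_pd 0
  have h1 := (hf.pd_two 1).continuous_pd 1
  have h2 := (hf.pd_two 1).continuous_pd 0
  have key := congrArg (2 * ·) (sub_eq_zero.2 h)
  simp only [mul_zero] at key
  rw [← sub_eq_zero, ← integral_sub (integrableOn_T2 (by fun_prop)) (integrableOn_T2 (by fun_prop)),
    ← key,
    ← integral_sub (integrableOn_T2 (by fun_prop)) (integrableOn_T2 (by fun_prop)),
    ← integral_const_mul]
  congr 1
  funext x
  ring

end Calculus

section PointwiseBounds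

lemma abs_le_add_of_sq_le {e α β : ℝ} (hα : 0 ≤ α) (hβ : 0 ≤ β) (h : e ^ 2 ≤ 4 * (α * β)) :
    |e| ≤ α + β :=
  abs_le_of_sq_le_sq (by nlinarith [sq_nonneg (α - β)]) (by positivity)

lemma inner_two_sq_le (x₀ x₁ y₀ y₁ : ℝ) :
    (x₀ * y₀ + x₁ * y₁) ^ 2 ≤ (x₀ ^ 2 + x₁ ^ 2) * (y₀ ^ 2 + y₁ ^ 2) := by
  nlinarith [sq_nonneg (x₀ * y₁ - x₁ * y₀)]

lemma abs_mul_inner_le {n P Q Dp Dq s : ℝ} (hs : 2 * (P ^ 2 + Q ^ 2) ≤ s ^ 2) :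
    |n * (P * Dp + Q * Dq)| ≤ n ^ 2 / 6 + 3 / 4 * s ^ 2 * (Dp ^ 2 + Dq ^ 2) := by
  refine abs_le_add_of_sq_le (by positivity) (by positivity) ?_
  have h1 := inner_two_sq_le P Q Dp Dq
  have h2 : (P ^ 2 + Q ^ 2) * (Dp ^ 2 + Dq ^ 2) ≤ s ^ 2 / 2 * (Dp ^ 2 + Dq ^ 2) := by
    gcongr; linarith
  calc (n * (P * Dp + Q * Dq)) ^ 2 = n ^ 2 * (P * Dp + Q * Dq) ^ 2 := by ring
    _ ≤ n ^ 2 * (s ^ 2 / 2 * (Dp ^ 2 + Dq ^ 2)) := by gcongr; linarith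
    _ = _ := by ring

lemma abs_grad_normSq_inner_le {P Q p₁ p₂ q₁ q₂ p₁₁ p₁₂ p₂₂ q₁₁ q₁₂ q₂₂ s : ℝ}
    (hs : 2 * (P ^ 2 + Q ^ 2) ≤ s ^ 2) :
    |2 * (p₁ * p₁₁ + p₂ * p₁₂ + q₁ * q₁₁ + q₂ * q₁₂) * (P * p₁ + Q * q₁) +
        2 * (p₁ * p₁₂ + p₂ * p₂₂ + q₁ * q₁₂ + q₂ * q₂₂) * (P * p₂ + Q * q₂)| ≤
      (p₁ ^ 2 + p₂ ^ 2 + q₁ ^ 2 + q₂ ^ 2) ^ 2 / 3 +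
        3 / 2 * s ^ 2 * ((p₁₁ ^ 2 + 2 * p₁₂ ^ 2 + p₂₂ ^ 2) + (q₁₁ ^ 2 + 2 * q₁₂ ^ 2 + q₂₂ ^ 2)) := by
  refine abs_le_add_of_sq_le (by positivity) (by positivity) ?_
  have hw₁ := inner_two_sq_le P Q p₁ q₁
  have hw₂ := inner_two_sq_le P Q p₂ q₂
  set w₁ := P * p₁ + Q * q₁
  set w₂ := P * p₂ + Q * q₂
  set n := p₁ ^ 2 + p₂ ^ 2 + q₁ ^ 2 + q₂ ^ 2 with hn
  have hw : w₁ ^ 2 + w₂ ^ 2 ≤ s ^ 2 / 2 * n := by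
    have : (P ^ 2 + Q ^ 2) * n ≤ s ^ 2 / 2 * n := by gcongr; linarith
    rw [hn] at this ⊢
    linarith
  set H := (p₁₁ ^ 2 + 2 * p₁₂ ^ 2 + p₂₂ ^ 2) + (q₁₁ ^ 2 + 2 * q₁₂ ^ 2 + q₂₂ ^ 2) with hH
  have cs := Finset.sum_mul_sq_le_sq_mul_sq Finset.univ
    ![p₁₁, p₁₂, q₁₁, q₁₂, p₁₂, p₂₂, q₁₂, q₂₂]
    ![p₁ * w₁, p₂ * w₁, q₁ * w₁, q₂ * w₁, p₁ * w₂, p₂ * w₂, q₁ * w₂, q₂ * w₂]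
  simp only [Fin.sum_univ_eight, Matrix.cons_val] at cs
  calc _ = 4 * (p₁₁ * (p₁ * w₁) + p₁₂ * (p₂ * w₁) + q₁₁ * (q₁ * w₁) + q₁₂ * (q₂ * w₁) +
        p₁₂ * (p₁ * w₂) + p₂₂ * (p₂ * w₂) + q₁₂ * (q₁ * w₂) + q₂₂ * (q₂ * w₂)) ^ 2 := by ring
    _ ≤ 4 * (H * (n * (w₁ ^ 2 + w₂ ^ 2))) := by
      refine mul_le_mul_of_nonneg_left (cs.trans_eq ?_) (by norm_num)
      rw [hH, hn]; ring
    _ ≤ 4 * (H * (n * (s ^ 2 / 2 * n))) := by gcongr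
    _ = _ := by ring

lemma laplacian_sq_le_of_eq {ζ L a c s δ P Q g₀ g₁ p₁ p₂ q₁ q₂ p₁₁ p₁₂ p₂₂ q₁₁ q₁₂ q₂₂ : ℝ}
    (hs : 0 < s) (hδ : 0 < δ) (hc : 0 < c) (hPQ : 2 * (P ^ 2 + Q ^ 2) ≤ s ^ 2)
    (ep : ζ * (p₁₁ + p₂₂) +
        2 * L * (P * (p₁₁ - p₂₂) + Q * (2 * p₁₂) + (p₁ * (p₁ + q₂) + p₂ * (q₁ - p₂))) -
        L * (p₁ ^ 2 + q₁ ^ 2 - p₂ ^ 2 - q₂ ^ 2) - a * P - c * (2 * (P ^ 2 + Q ^ 2)) * P = g₀)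
    (eq : ζ * (q₁₁ + q₂₂) +
        2 * L * (P * (q₁₁ - q₂₂) + Q * (2 * q₁₂) + (q₁ * (p₁ + q₂) + q₂ * (q₁ - p₂))) -
        L * (2 * (p₁ * p₂ + q₁ * q₂)) - a * Q - c * (2 * (P ^ 2 + Q ^ 2)) * Q = g₁) :
    ζ * ((p₁₁ + p₂₂) ^ 2 + (q₁₁ + q₂₂) ^ 2) ≤
      (δ / 2 + |L| * (11 / 2 * s)) * ((p₁₁ + p₂₂) ^ 2 + (q₁₁ + q₂₂) ^ 2) +
        |L| * s * ((p₁₁ ^ 2 + 2 * p₁₂ ^ 2 + p₂₂ ^ 2) + (q₁₁ ^ 2 + 2 * q₁₂ ^ 2 + q₂₂ ^ 2)) +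
        |L| / s * (p₁ ^ 2 + p₂ ^ 2 + q₁ ^ 2 + q₂ ^ 2) ^ 2 +
        (g₀ ^ 2 + g₁ ^ 2) / δ + (|a| + c * s ^ 2) ^ 2 * s ^ 2 / (2 * δ) := by
  set n := p₁ ^ 2 + p₂ ^ 2 + q₁ ^ 2 + q₂ ^ 2 with hn
  set H := (p₁₁ ^ 2 + 2 * p₁₂ ^ 2 + p₂₂ ^ 2) + (q₁₁ ^ 2 + 2 * q₁₂ ^ 2 + q₂₂ ^ 2) with hH
  set K := |a| + c * s ^ 2
  set Dp := p₁₁ + p₂₂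
  set Dq := q₁₁ + q₂₂
  set D := Dp ^ 2 + Dq ^ 2
  have hD : 0 ≤ D := by positivity
  have hHn : 0 ≤ H := by positivity
  set Ap := P * (p₁₁ - p₂₂) + Q * (2 * p₁₂)
  set Aq := P * (q₁₁ - q₂₂) + Q * (2 * q₁₂)
  set Bp := p₁ * (p₁ + q₂) + p₂ * (q₁ - p₂)
  set Bq := q₁ * (p₁ + q₂) + q₂ * (q₁ - p₂)
  set Cp := p₁ ^ 2 + q₁ ^ 2 - p₂ ^ 2 - q₂ ^ 2 with hCp
  set Cq := 2 * (p₁ * p₂ + q₁ * q₂) with hCq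
  have hA : Ap ^ 2 + Aq ^ 2 ≤ s ^ 2 * H := by
    have h1 := inner_two_sq_le P Q (p₁₁ - p₂₂) (2 * p₁₂)
    have h2 := inner_two_sq_le P Q (q₁₁ - q₂₂) (2 * q₁₂)
    have h3 : ((p₁₁ - p₂₂) ^ 2 + (2 * p₁₂) ^ 2) + ((q₁₁ - q₂₂) ^ 2 + (2 * q₁₂) ^ 2) ≤ 2 * H := by
      linarith [sq_nonneg (p₁₁ + p₂₂), sq_nonneg (q₁₁ + q₂₂)]
    calc Ap ^ 2 + Aq ^ 2 ≤ (P ^ 2 + Q ^ 2) * (((p₁₁ - p₂₂) ^ 2 + (2 * p₁₂) ^ 2) +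
          ((q₁₁ - q₂₂) ^ 2 + (2 * q₁₂) ^ 2)) := by linarith
      _ ≤ (s ^ 2 / 2) * (2 * H) := by gcongr; linarith
      _ = _ := by ring
  have hB : Bp ^ 2 + Bq ^ 2 ≤ 2 * n ^ 2 := by
    have h1 := inner_two_sq_le p₁ p₂ (p₁ + q₂) (q₁ - p₂)
    have h2 := inner_two_sq_le q₁ q₂ (p₁ + q₂) (q₁ - p₂)
    have h3 : (p₁ + q₂) ^ 2 + (q₁ - p₂) ^ 2 ≤ 2 * n := by
      linarith [sq_nonneg (p₁ - q₂), sq_nonneg (q₁ + p₂)]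
    calc Bp ^ 2 + Bq ^ 2 ≤ n * ((p₁ + q₂) ^ 2 + (q₁ - p₂) ^ 2) := by
          rw [hn]; linarith
      _ ≤ n * (2 * n) := by gcongr
      _ = _ := by ring
  have hC : Cp ^ 2 + Cq ^ 2 ≤ n ^ 2 := by
    have := inner_two_sq_le p₁ q₁ p₂ q₂
    rw [hn, hCp, hCq]
    linarith
  have hR : |a + c * (2 * (P ^ 2 + Q ^ 2))| ≤ K := by
    refine (abs_add_le _ _).trans ?_
    rw [abs_of_nonneg (by positivity : 0 ≤ c * (2 * (P ^ 2 + Q ^ 2)))]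
    exact add_le_add le_rfl (mul_le_mul_of_nonneg_left hPQ hc.le)
  set R := a + c * (2 * (P ^ 2 + Q ^ 2))
  have tA : |2 * (Dp * Ap + Dq * Aq)| ≤ s * D + s * H := by
    refine abs_le_add_of_sq_le (by positivity) (by positivity) ?_
    have := mul_le_mul_of_nonneg_left hA hD
    linarith [inner_two_sq_le Dp Dq Ap Aq]
  have tB : |2 * (Dp * Bp + Dq * Bq)| ≤ 2 / 3 * (n ^ 2 / s) + 3 * s * D := by
    refine abs_le_add_of_sq_le (by positivity) (by positivity) ?_
    have := mul_le_mul_of_nonneg_left hB hD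
    have e : 4 * (2 / 3 * (n ^ 2 / s) * (3 * s * D)) = 4 * (D * (2 * n ^ 2)) := by
      field_simp
    linarith [inner_two_sq_le Dp Dq Bp Bq]
  have tC : |Dp * Cp + Dq * Cq| ≤ 1 / 3 * (n ^ 2 / s) + 3 / 2 * s * D := by
    refine abs_le_add_of_sq_le (by positivity) (by positivity) ?_
    have := mul_le_mul_of_nonneg_left hC hD
    have e : 4 * (1 / 3 * (n ^ 2 / s) * (3 / 2 * s * D)) = 2 * (D * n ^ 2) := by
      field_simp
      ring
    have : 0 ≤ D * n ^ 2 := by positivity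
    linarith [inner_two_sq_le Dp Dq Cp Cq]
  have tg : |Dp * g₀ + Dq * g₁| ≤ δ / 4 * D + (g₀ ^ 2 + g₁ ^ 2) / δ := by
    refine abs_le_add_of_sq_le (by positivity) (by positivity) ?_
    have e : 4 * (δ / 4 * D * ((g₀ ^ 2 + g₁ ^ 2) / δ)) = D * (g₀ ^ 2 + g₁ ^ 2) := by
      field_simp
    rw [e]
    exact inner_two_sq_le Dp Dq g₀ g₁
  have tR : |R * (Dp * P + Dq * Q)| ≤ δ / 4 * D + K ^ 2 * s ^ 2 / (2 * δ) := by
    refine abs_le_add_of_sq_le (by positivity) (by positivity) ?_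
    have e : 4 * (δ / 4 * D * (K ^ 2 * s ^ 2 / (2 * δ))) = K ^ 2 * (D * (s ^ 2 / 2)) := by
      field_simp
    rw [e, mul_pow]
    have h1 : R ^ 2 ≤ K ^ 2 := sq_le_sq' (abs_le.1 hR).1 (abs_le.1 hR).2
    have h2 : D * (P ^ 2 + Q ^ 2) ≤ D * (s ^ 2 / 2) := by gcongr; linarith
    gcongr
    exact (inner_two_sq_le Dp Dq P Q).trans h2
  have hL : -(L * (2 * (Dp * Ap + Dq * Aq) + 2 * (Dp * Bp + Dq * Bq) - (Dp * Cp + Dq * Cq))) ≤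
      |L| * (s * D + s * H + (2 / 3 * (n ^ 2 / s) + 3 * s * D) +
        (1 / 3 * (n ^ 2 / s) + 3 / 2 * s * D)) := by
    refine (neg_le_abs _).trans ?_
    rw [abs_mul]
    gcongr
    refine (abs_sub _ _).trans (add_le_add ((abs_add_le _ _).trans (add_le_add tA tB)) tC)
  have e : ζ * D = (Dp * g₀ + Dq * g₁) + R * (Dp * P + Dq * Q) +
      -(L * (2 * (Dp * Ap + Dq * Aq) + 2 * (Dp * Bp + Dq * Bq) - (Dp * Cp + Dq * Cq))) := by
    rw [← ep, ← eq]
    ring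
  have e' : |L| / s * n ^ 2 = |L| * (n ^ 2 / s) := by ring
  rw [e, e']
  linarith [le_abs_self (Dp * g₀ + Dq * g₁), le_abs_self (R * (Dp * P + Dq * Q))]

end PointwiseBounds

section Integrated

variable {p q : (Fin 2 → ℝ) → ℝ}

lemma setIntegral_T2_grad_pow_four_le (hp : ContDiff ℝ 2 p) (hq : ContDiff ℝ 2 q)
    (hpp : Per p) (hqp : Per q) {s : ℝ} (hs : ∀ x, 2 * (p x ^ 2 + q x ^ 2) ≤ s ^ 2) :
    ∫ x in T2, (pd 0 p x ^ 2 + pd 1 p x ^ 2 + pd 0 q x ^ 2 + pd 1 q x ^ 2) ^ 2 ≤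
      9 / 2 * s ^ 2 * ∫ x in T2, ((pd 0 (pd 0 p) x + pd 1 (pd 1 p) x) ^ 2 +
        (pd 0 (pd 0 q) x + pd 1 (pd 1 q) x) ^ 2) := by
  have hp₁ := hp.of_le (m := 1) (by norm_num)
  have hq₁ := hq.of_le (m := 1) (by norm_num)
  have cp := hp.continuous
  have cq := hq.continuous
  have dp (i) := hp.pd_two i
  have dq (i) := hq.pd_two i
  have cdp (i) := (dp i).continuous
  have cdq (i) := (dq i).continuous
  have cddp (i j) := (dp j).continuous_pd i
  have cddq (i j) := (dq j).continuous_pd i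
  set n : (Fin 2 → ℝ) → ℝ := fun x => pd 0 p x ^ 2 + pd 1 p x ^ 2 + pd 0 q x ^ 2 + pd 1 q x ^ 2
    with hn
  have dn : ContDiff ℝ 1 n := by fun_prop
  have cn := dn.continuous
  have cdn (i) := dn.continuous_pd i
  have hnp : Per n := fun x i => by
    simp only [hn, hpp.pd _ x i, hqp.pd _ x i]
  have pdn (i : Fin 2) (x) : pd i n x = 2 * (pd 0 p x * pd i (pd 0 p) x + pd 1 p x * pd i (pd 1 p) x
      + pd 0 q x * pd i (pd 0 q) x + pd 1 q x * pd i (pd 1 q) x) := by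
    simp only [hn, sq]
    have h00 := dp 0
    have h01 := dp 1
    have h10 := dq 0
    have h11 := dq 1
    rw [pd_add (by fun_prop) (by fun_prop), pd_add (by fun_prop) (by fun_prop),
      pd_add (by fun_prop) (by fun_prop), pd_mul h00 h00, pd_mul h01 h01, pd_mul h10 h10,
      pd_mul h11 h11]
    ring
  have div (i : Fin 2) : ∫ x in T2, (pd i n x * (p x * pd i p x + q x * pd i q x) +
      n x * (pd i p x ^ 2 + pd i q x ^ 2 + (p x * pd i (pd i p) x + q x * pd i (pd i q) x))) = 0 := by
    have hi := dp i
    have hi' := dq i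
    rw [← setIntegral_T2_pd (f := fun x => n x * (p x * pd i p x + q x * pd i q x)) (by fun_prop)
      (fun x j => by simp only [hnp x j, hpp x j, hqp x j, hpp.pd _ x j, hqp.pd _ x j]) i]
    congr 1
    funext x
    rw [pd_mul dn (by fun_prop), pd_add (hp₁.mul hi) (hq₁.mul hi'), pd_mul hp₁ hi, pd_mul hq₁ hi']
    ring
  have pw (x) : n x ^ 2 ≤
      ((pd 0 n x * (p x * pd 0 p x + q x * pd 0 q x) +
        n x * (pd 0 p x ^ 2 + pd 0 q x ^ 2 + (p x * pd 0 (pd 0 p) x + q x * pd 0 (pd 0 q) x))) +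
      (pd 1 n x * (p x * pd 1 p x + q x * pd 1 q x) +
        n x * (pd 1 p x ^ 2 + pd 1 q x ^ 2 + (p x * pd 1 (pd 1 p) x + q x * pd 1 (pd 1 q) x)))) +
      (1 / 2 * n x ^ 2 + 3 / 4 * s ^ 2 * ((pd 0 (pd 0 p) x + pd 1 (pd 1 p) x) ^ 2 +
        (pd 0 (pd 0 q) x + pd 1 (pd 1 q) x) ^ 2) + 3 / 2 * s ^ 2 *
        ((pd 0 (pd 0 p) x ^ 2 + 2 * pd 0 (pd 1 p) x ^ 2 + pd 1 (pd 1 p) x ^ 2) +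
        (pd 0 (pd 0 q) x ^ 2 + 2 * pd 0 (pd 1 q) x ^ 2 + pd 1 (pd 1 q) x ^ 2))) := by
    have h1 := abs_mul_inner_le (n := n x) (Dp := pd 0 (pd 0 p) x + pd 1 (pd 1 p) x)
      (Dq := pd 0 (pd 0 q) x + pd 1 (pd 1 q) x) (hs x)
    have h2 := abs_grad_normSq_inner_le (p₁ := pd 0 p x) (p₂ := pd 1 p x) (q₁ := pd 0 q x)
      (q₂ := pd 1 q x) (p₁₁ := pd 0 (pd 0 p) x) (p₁₂ := pd 0 (pd 1 p) x)
      (p₂₂ := pd 1 (pd 1 p) x) (q₁₁ := pd 0 (pd 0 q) x) (q₁₂ := pd 0 (pd 1 q) x)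
      (q₂₂ := pd 1 (pd 1 q) x) (hs x)
    have h1' := (abs_le.1 h1).1
    have h2' := (abs_le.1 h2).1
    rw [pdn, pdn, pd_comm hp 1 0, pd_comm hq 1 0]
    have e : n x = pd 0 p x ^ 2 + pd 1 p x ^ 2 + pd 0 q x ^ 2 + pd 1 q x ^ 2 := rfl
    rw [← e] at h2'
    have e2 : n x ^ 2 = n x * (pd 0 p x ^ 2 + pd 1 p x ^ 2 + pd 0 q x ^ 2 + pd 1 q x ^ 2) := by
      rw [← e, sq]
    linarith
  have hlap_p := setIntegral_T2_laplacian_sq hp hpp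
  have hlap_q := setIntegral_T2_laplacian_sq hq hqp
  have I := setIntegral_T2_mono (by fun_prop) (by fun_prop) pw
  rw [integral_add (integrableOn_T2 (by fun_prop)) (integrableOn_T2 (by fun_prop)),
    integral_add (integrableOn_T2 (by fun_prop)) (integrableOn_T2 (by fun_prop)), div, div,
    integral_add (integrableOn_T2 (by fun_prop)) (integrableOn_T2 (by fun_prop)),
    integral_add (integrableOn_T2 (by fun_prop)) (integrableOn_T2 (by fun_prop)),
    integral_const_mul, integral_const_mul, integral_const_mul,
    integral_add (integrableOn_T2 (by fun_prop)) (integrableOn_T2 (by fun_prop)),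
    integral_add (f := fun x => pd 0 (pd 0 p) x ^ 2 + _ + _)
      (integrableOn_T2 (by fun_prop)) (integrableOn_T2 (by fun_prop)), ← hlap_p, ← hlap_q] at I
  rw [integral_add (integrableOn_T2 (by fun_prop)) (integrableOn_T2 (by fun_prop))]
  linarith

end Integrated

/-- Elliptic `H²` estimate for the Q-tensor equation with small `L^∞` norm:
for `ζ > 0`, `L₄ ≠ 0`, `c > 0` and `0 < η < (1/121)(ζ/L₄)²`, there is a constant `C`
(depending only on `a, c, L₄, ζ, η` and `𝕋²`) such that every `C²` periodic
`Q : 𝕋² → 𝒮₀^{(2)}` with `‖Q‖_{L^∞} ≤ √η` solving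
`ζΔQ_{ij} + 2L₄∂ₖ(∂ₗQ_{ij} Q_{lk}) − L₄∂ᵢQ_{kl}∂ⱼQ_{kl} + (L₄/2)|∇Q|²δ_{ij}
 − aQ_{ij} − c tr(Q²)Q_{ij} = g_{ij}` satisfies `‖Q‖_{H²} ≤ C(‖g‖_{L²} + 1)`. -/
theorem elliptic_H2_estimate (ζ L₄ a c η : ℝ)
    (hζ : 0 < ζ) (hL₄ : L₄ ≠ 0) (hc : 0 < c)
    (hη : 0 < η) (hη' : η < (1/121) * (ζ / L₄)^2) :
    ∃ C > 0,
      ∀ (Q : (Fin 2 → ℝ) → Matrix (Fin 2) (Fin 2) ℝ)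
        (g : (Fin 2 → ℝ) → Matrix (Fin 2) (Fin 2) ℝ),
        (∀ i j, ContDiff ℝ 2 (fun x => Q x i j)) →
        (∀ i j, Per (fun x => Q x i j)) →
        (∀ x, (Q x).IsSymm) → (∀ x, (Q x).trace = 0) →
        (∀ i j, Continuous (fun x => g x i j)) →
        (∀ i j, Per (fun x => g x i j)) →
        (∀ x, ∑ i, ∑ j, (Q x i j)^2 ≤ η) →
        (∀ (x : Fin 2 → ℝ) (i j : Fin 2),
          ζ * (∑ k, pd k (pd k (fun y => Q y i j)) x)
            + 2 * L₄ * (∑ k, pd k (fun y =>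
                ∑ l, pd l (fun z => Q z i j) y * Q y l k) x)
            - L₄ * (∑ k, ∑ l,
                pd i (fun z => Q z k l) x * pd j (fun z => Q z k l) x)
            + (L₄ / 2) * (∑ m, ∑ k, ∑ l, (pd m (fun z => Q z k l) x)^2)
                * (if i = j then 1 else 0)
            - a * Q x i j - c * (Q x * Q x).trace * Q x i j
          = g x i j) →
        Real.sqrt (∫ x in T2,
            (∑ i, ∑ j, (Q x i j)^2)
              + (∑ k, ∑ i, ∑ j, (pd k (fun y => Q y i j) x)^2)
              + (∑ k, ∑ l, ∑ i, ∑ j, (pd k (pd l (fun y => Q y i j)) x)^2))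
          ≤ C * (Real.sqrt (∫ x in T2, ∑ i, ∑ j, (g x i j)^2) + 1) := by
  have hL : 0 < |L₄| := abs_pos.2 hL₄
  obtain ⟨s, hs, hsη⟩ : ∃ s, 0 < s ∧ s ^ 2 = η := ⟨√η, Real.sqrt_pos.2 hη, Real.sq_sqrt hη.le⟩
  obtain ⟨δ, hδ, hδζ⟩ : ∃ δ, 0 < δ ∧ ζ = δ + 11 * s * |L₄| := by
    refine ⟨ζ - 11 * s * |L₄|, ?_, by ring⟩
    have h : (11 * s * |L₄|) ^ 2 < ζ ^ 2 := by
      rw [div_pow, ← sq_abs L₄, ← hsη, ← mul_div_assoc, lt_div_iff₀ (by positivity)] at hη'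
      linarith
    linarith [lt_of_pow_lt_pow_left₀ 2 hζ.le h]
  set K := |a| + c * s ^ 2
  set α := 1 + s ^ 2 + (9 / 2 * s ^ 2 + 2) * (K ^ 2 * s ^ 2 / δ ^ 2) with hα
  set β := (9 / 2 * s ^ 2 + 2) * (2 / δ ^ 2) with hβ
  have hα0 : 0 < α := by positivity
  have hβ0 : 0 < β := by positivity
  refine ⟨√(α + β), by positivity, ?_⟩
  intro Q g hQ hQp hsymm htr hg hgp hQη heq
  set p : (Fin 2 → ℝ) → ℝ := fun x => Q x 0 0
  set q : (Fin 2 → ℝ) → ℝ := fun x => Q x 0 1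
  have hp : ContDiff ℝ 2 p := hQ 0 0
  have hq : ContDiff ℝ 2 q := hQ 0 1
  have hpp : Per p := hQp 0 0
  have hqp : Per q := hQp 0 1
  have e00 (x) : Q x 0 0 = p x := rfl
  have e01 (x) : Q x 0 1 = q x := rfl
  have e10 (x) : Q x 1 0 = q x := (hsymm x).apply 0 1
  have e11 (x) : Q x 1 1 = -p x := by
    have := htr x
    rw [Matrix.trace_fin_two] at this
    linarith [e00 x]
  have hpq (x) : 2 * (p x ^ 2 + q x ^ 2) ≤ s ^ 2 := by
    have := hQη x
    simp only [Fin.sum_univ_two, e00, e01, e10, e11] at this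
    linarith
  have dp (i) := hp.pd_two i
  have dq (i) := hq.pd_two i
  have cp := hp.continuous
  have cq := hq.continuous
  have cdp (i) := (dp i).continuous
  have cdq (i) := (dq i).continuous
  have cddp (i j) := (dp j).continuous_pd i
  have cddq (i j) := (dq j).continuous_pd i
  have hp₁ := hp.of_le (m := 1) (by norm_num)
  have hq₁ := hq.of_le (m := 1) (by norm_num)
  have hnp₁ : ContDiff ℝ 1 fun x => -p x := hp₁.neg
  have transport {f : (Fin 2 → ℝ) → ℝ} (hf : ContDiff ℝ 2 f) (x) :
      pd 0 (fun y => pd 0 f y * p y + pd 1 f y * q y) x +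
        pd 1 (fun y => pd 0 f y * q y + pd 1 f y * -p y) x =
      p x * (pd 0 (pd 0 f) x - pd 1 (pd 1 f) x) + q x * (2 * pd 0 (pd 1 f) x) +
        (pd 0 f x * (pd 0 p x + pd 1 q x) + pd 1 f x * (pd 0 q x - pd 1 p x)) := by
    have h0 := hf.pd_two 0
    have h1 := hf.pd_two 1
    rw [pd_add (h0.mul hp₁) (h1.mul hq₁), pd_add (h0.mul hq₁) (h1.mul hnp₁), pd_mul h0 hp₁,
      pd_mul h1 hq₁, pd_mul h0 hq₁, pd_mul h1 hnp₁, pd_neg, pd_comm hf 1 0]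
    ring
  have pw (x) := laplacian_sq_le_of_eq (ζ := ζ) (L := L₄) (a := a) (c := c) (s := s) (δ := δ)
    (P := p x) (Q := q x) (g₀ := g x 0 0) (g₁ := g x 0 1) (p₁ := pd 0 p x) (p₂ := pd 1 p x)
    (q₁ := pd 0 q x) (q₂ := pd 1 q x) (p₁₁ := pd 0 (pd 0 p) x) (p₁₂ := pd 0 (pd 1 p) x)
    (p₂₂ := pd 1 (pd 1 p) x) (q₁₁ := pd 0 (pd 0 q) x) (q₁₂ := pd 0 (pd 1 q) x)
    (q₂₂ := pd 1 (pd 1 q) x) hs hδ hc (hpq x)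
    (by
      have h := heq x 0 0
      simp only [Fin.sum_univ_two, e00, e01, e10, e11, Matrix.trace_fin_two, Matrix.mul_apply,
        pd_neg, transport hp, if_true] at h
      linarith)
    (by
      have h := heq x 0 1
      simp only [Fin.sum_univ_two, e00, e01, e10, e11, Matrix.trace_fin_two, Matrix.mul_apply,
        pd_neg, transport hq, zero_ne_one, if_false] at h
      linarith)
  have hlap_p := setIntegral_T2_laplacian_sq hp hpp
  have hlap_q := setIntegral_T2_laplacian_sq hq hqp
  have hgrad := setIntegral_T2_grad_pow_four_le hp hq hpp hqp hpq
  have cg00 := hg 0 0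
  have cg01 := hg 0 1
  have cg10 := hg 1 0
  have cg11 := hg 1 1
  set D : (Fin 2 → ℝ) → ℝ := fun x => (pd 0 (pd 0 p) x + pd 1 (pd 1 p) x) ^ 2 +
    (pd 0 (pd 0 q) x + pd 1 (pd 1 q) x) ^ 2 with hD
  set H : (Fin 2 → ℝ) → ℝ := fun x =>
    (pd 0 (pd 0 p) x ^ 2 + 2 * pd 0 (pd 1 p) x ^ 2 + pd 1 (pd 1 p) x ^ 2) +
    (pd 0 (pd 0 q) x ^ 2 + 2 * pd 0 (pd 1 q) x ^ 2 + pd 1 (pd 1 q) x ^ 2) with hH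
  set N : (Fin 2 → ℝ) → ℝ := fun x =>
    (pd 0 p x ^ 2 + pd 1 p x ^ 2 + pd 0 q x ^ 2 + pd 1 q x ^ 2) ^ 2 with hN
  have hDH : ∫ x in T2, H x = ∫ x in T2, D x := by
    refine (integral_add (integrableOn_T2 (by fun_prop)) (integrableOn_T2 (by fun_prop))).trans ?_
    rw [← hlap_p, ← hlap_q]
    exact (integral_add (integrableOn_T2 (by fun_prop)) (integrableOn_T2 (by fun_prop))).symm
  have cD : Continuous D := by fun_prop
  have cH : Continuous H := by fun_prop
  have cN : Continuous N := by fun_prop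
  replace pw (x) : ζ * D x ≤ (δ / 2 + |L₄| * (11 / 2 * s)) * D x + |L₄| * s * H x +
      |L₄| / s * N x + (g x 0 0 ^ 2 + g x 0 1 ^ 2) / δ + K ^ 2 * s ^ 2 / (2 * δ) := pw x
  clear_value D H N K
  set G : (Fin 2 → ℝ) → ℝ := fun x => ∑ i, ∑ j, g x i j ^ 2 with hG
  have cG : Continuous G := by
    simp only [hG, Fin.sum_univ_two]
    fun_prop
  have pw' (x) : ζ * D x ≤ (δ / 2 + |L₄| * (11 / 2 * s)) * D x + |L₄| * s * H x + |L₄| / s * N x +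
      (1 / δ * G x + K ^ 2 * s ^ 2 / (2 * δ)) := by
    have h : (g x 0 0 ^ 2 + g x 0 1 ^ 2) / δ ≤ 1 / δ * G x := by
      rw [div_eq_mul_one_div, mul_comm]
      gcongr
      simp only [hG, Fin.sum_univ_two]
      linarith [sq_nonneg (g x 1 0), sq_nonneg (g x 1 1)]
    linarith [pw x]
  have I := setIntegral_T2_mono (by fun_prop) (by fun_prop) pw'
  have cst (r : ℝ) : ∫ _ in T2, r = r := by
    rw [setIntegral_const, volume_real_T2, one_smul]
  rw [integral_add (integrableOn_T2 (by fun_prop)) (integrableOn_T2 (by fun_prop)),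
    integral_add (integrableOn_T2 (by fun_prop)) (integrableOn_T2 (by fun_prop)),
    integral_add (integrableOn_T2 (by fun_prop)) (integrableOn_T2 (by fun_prop)),
    integral_add (integrableOn_T2 (by fun_prop)) (integrableOn_T2 (by fun_prop)), cst,
    integral_const_mul, integral_const_mul, integral_const_mul, integral_const_mul,
    integral_const_mul, hDH] at I
  set X := ∫ x in T2, D x
  set Y := ∫ x in T2, N x
  set Z := ∫ x in T2, G x
  have hZ : 0 ≤ Z := integral_nonneg fun x => by positivity
  have hX : X ≤ 2 / δ ^ 2 * Z + K ^ 2 * s ^ 2 / δ ^ 2 := by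
    have h1 : |L₄| / s * Y ≤ |L₄| / s * (9 / 2 * s ^ 2 * X) := by gcongr
    have h2 : |L₄| / s * (9 / 2 * s ^ 2 * X) = |L₄| * (9 / 2 * s) * X := by
      field_simp
    have h3 : δ / 2 * X ≤ 1 / δ * Z + K ^ 2 * s ^ 2 / (2 * δ) := by
      rw [hδζ] at I
      linarith
    calc X = 2 / δ * (δ / 2 * X) := by field_simp
      _ ≤ 2 / δ * (1 / δ * Z + K ^ 2 * s ^ 2 / (2 * δ)) := by gcongr
      _ = _ := by field_simp
  have total : ∫ x in T2, ((∑ i, ∑ j, (Q x i j) ^ 2)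
        + (∑ k, ∑ i, ∑ j, (pd k (fun y => Q y i j) x) ^ 2)
        + (∑ k, ∑ l, ∑ i, ∑ j, (pd k (pd l (fun y => Q y i j)) x) ^ 2)) ≤ α + β * Z := by
    have hpt (x) : (2 * (p x ^ 2 + q x ^ 2) +
        2 * (pd 0 p x ^ 2 + pd 1 p x ^ 2 + pd 0 q x ^ 2 + pd 1 q x ^ 2)) + 2 * H x ≤
        (1 + s ^ 2) + N x + 2 * H x := by
      have := sq_nonneg (pd 0 p x ^ 2 + pd 1 p x ^ 2 + pd 0 q x ^ 2 + pd 1 q x ^ 2 - 1)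
      have e := congrFun hN x
      linarith [hpq x]
    have J := setIntegral_T2_mono (by fun_prop) (by fun_prop) hpt
    rw [integral_add (f := fun x => (1 + s ^ 2) + N x)
      (integrableOn_T2 (by fun_prop)) (integrableOn_T2 (by fun_prop)),
      integral_add (f := fun _ => 1 + s ^ 2)
      (integrableOn_T2 (by fun_prop)) (integrableOn_T2 (by fun_prop)), cst, integral_const_mul,
      hDH] at J
    refine le_trans (le_of_eq ?_) (J.trans ?_)
    · congr 1
      funext x
      simp only [Fin.sum_univ_two, e00, e01, e10, e11, pd_neg, congrFun hH, pd_comm hp 1 0,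
        pd_comm hq 1 0]
      ring
    · have h : (9 / 2 * s ^ 2 + 2) * X ≤
          (9 / 2 * s ^ 2 + 2) * (2 / δ ^ 2 * Z + K ^ 2 * s ^ 2 / δ ^ 2) := by gcongr
      rw [hα, hβ]
      linarith
  refine (Real.sqrt_le_sqrt total).trans ?_
  rw [Real.sqrt_le_left (by positivity), mul_pow, Real.sq_sqrt (by positivity)]
  have h1 := Real.sq_sqrt hZ
  have h2 := Real.sqrt_nonneg Z
  calc α + β * Z ≤ (α + β) * (1 + Z) := by nlinarith
    _ ≤ (α + β) * (√Z + 1) ^ 2 := by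
      gcongr
      linarith
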